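/- If a and b are strongly cospectral vertices of a finite simple graph X, then every automorphism of X that fixes a also fixes b. -/

import Mathlib

open Matrix BigOperators

/-- A spectral decomposition of a real symmetric matrix `A`: the `θ r` are the distinct
eigenvalues and `E r` is the orthogonal projection onto the `θ r`-eigenspace. -/
structure IsSpectralDecomp {V : Type*} [Fintype V] [DecidableEq V] (A : Matrix V V ℝ)
    {m : ℕ} (θ : Fin m → ℝ) (E : Fin m → Matrix V V ℝ) : Prop where
  theta_inj : Function.Injective θ
  symm : ∀ r, (E r)ᵀ = E r
  idem : ∀ r, E r * E r = E r
  mul_eq_zero : ∀ r s, r ≠ s → E r * E s = 0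
  sum_eq_one : ∑ r, E r = 1
  eq_sum : A = ∑ r, θ r • E r
  ne_zero : ∀ r, E r ≠ 0

namespace IsSpectralDecomp

variable {V : Type*} [Fintype V] [DecidableEq V] {A : Matrix V V ℝ} {m : ℕ} {θ : Fin m → ℝ}
  {E : Fin m → Matrix V V ℝ}

theorem mul_proj (h : IsSpectralDecomp A θ E) (r : Fin m) : A * E r = θ r • E r := by
  rw [h.eq_sum, Finset.sum_mul, Finset.sum_eq_single r]
  · rw [smul_mul_assoc, h.idem]
  · intro s _ hs
    rw [smul_mul_assoc, h.mul_eq_zero s r hs, smul_zero]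
  · simp

theorem proj_mul (h : IsSpectralDecomp A θ E) (r : Fin m) : E r * A = θ r • E r := by
  rw [h.eq_sum, Finset.mul_sum, Finset.sum_eq_single r]
  · rw [mul_smul_comm, h.idem]
  · intro s _ hs
    rw [mul_smul_comm, h.mul_eq_zero r s hs.symm, smul_zero]
  · simp

theorem proj_mul_mul_proj_eq_zero (h : IsSpectralDecomp A θ E) {P : Matrix V V ℝ}
    (hP : Commute A P) {r s : Fin m} (hrs : r ≠ s) : E r * P * E s = 0 := by
  have key : θ r • (E r * P * E s) = θ s • (E r * P * E s) := by
    calc θ r • (E r * P * E s) = E r * A * P * E s := by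
          rw [h.proj_mul, smul_mul_assoc, smul_mul_assoc]
      _ = E r * P * (A * E s) := by
          rw [mul_assoc (E r), hP.eq]
          simp only [mul_assoc]
      _ = θ s • (E r * P * E s) := by rw [h.mul_proj, mul_smul_comm]
  rw [← sub_eq_zero, ← sub_smul] at key
  exact (smul_eq_zero.mp key).resolve_left (sub_ne_zero.mpr (h.theta_inj.ne hrs))

/-- A matrix commuting with `A` commutes with every spectral projection of `A`. -/
theorem commute_proj (h : IsSpectralDecomp A θ E) {P : Matrix V V ℝ} (hP : Commute A P)
    (r : Fin m) : Commute (E r) P := by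
  have left : E r * P = E r * P * E r := by
    conv_lhs => rw [← mul_one (E r * P), ← h.sum_eq_one, Finset.mul_sum]
    exact Finset.sum_eq_single r
      (fun s _ hs => h.proj_mul_mul_proj_eq_zero hP hs.symm) (by simp)
  have right : P * E r = E r * P * E r := by
    conv_lhs => rw [← one_mul (P * E r), ← h.sum_eq_one, Finset.sum_mul]
    simp only [← mul_assoc]
    exact Finset.sum_eq_single r
      (fun s _ hs => h.proj_mul_mul_proj_eq_zero hP hs) (by simp)
  exact left.trans right.symm

theorem eq_of_proj_mulVec_eq (h : IsSpectralDecomp A θ E) {v w : V → ℝ}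
    (hvw : ∀ r, E r *ᵥ v = E r *ᵥ w) : v = w := by
  rw [← one_mulVec v, ← one_mulVec w, ← h.sum_eq_one, sum_mulVec, sum_mulVec]
  exact Finset.sum_congr rfl fun r _ => hvw r

/-- A matrix commuting with `A` and fixing `v` fixes every `w` whose spectral projections agree
with those of `v` up to sign. -/
theorem mulVec_eq_of_proj_eq_or_neg (h : IsSpectralDecomp A θ E) {P : Matrix V V ℝ}
    (hP : Commute A P) {v w : V → ℝ}
    (hvw : ∀ r, E r *ᵥ v = E r *ᵥ w ∨ E r *ᵥ v = -(E r *ᵥ w)) (hv : P *ᵥ v = v) :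
    P *ᵥ w = w := by
  refine h.eq_of_proj_mulVec_eq fun r => ?_
  have hfix : P *ᵥ (E r *ᵥ v) = E r *ᵥ v := by
    rw [mulVec_mulVec, ← (h.commute_proj hP r).eq, ← mulVec_mulVec, hv]
  rw [mulVec_mulVec, (h.commute_proj hP r).eq, ← mulVec_mulVec]
  rcases hvw r with hr | hr
  · rwa [hr] at hfix
  · rw [hr, mulVec_neg] at hfix
    exact neg_injective hfix

end IsSpectralDecomp

theorem SimpleGraph.commute_adjMatrix_permMatrix {V : Type*} [Fintype V] [DecidableEq V]
    (X : SimpleGraph V) [DecidableRel X.Adj] (σ : Equiv.Perm V)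
    (hσ : ∀ u v : V, X.Adj (σ u) (σ v) ↔ X.Adj u v) :
    Commute (X.adjMatrix ℝ) (σ.permMatrix ℝ) := by
  ext i j
  rw [Equiv.Perm.permMatrix, PEquiv.mul_toMatrix_toPEquiv, PEquiv.toMatrix_toPEquiv_mul]
  have := hσ i (σ.symm j)
  simp only [Equiv.apply_symm_apply] at this
  simp [SimpleGraph.adjMatrix_apply, this]

/-- If `a` and `b` are strongly cospectral, then every automorphism of `X` fixing `a`
also fixes `b`. -/
theorem automorphism_fixes_of_stronglyCospectral {V : Type*} [Fintype V] [DecidableEq V]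
    (X : SimpleGraph V) [DecidableRel X.Adj] {m : ℕ} (θ : Fin m → ℝ)
    (E : Fin m → Matrix V V ℝ) (hdec : IsSpectralDecomp (X.adjMatrix ℝ) θ E) (a b : V)
    (hsc : ∀ r, E r *ᵥ Pi.single a 1 = E r *ᵥ Pi.single b 1 ∨
        E r *ᵥ Pi.single a 1 = -(E r *ᵥ Pi.single b 1))
    (σ : Equiv.Perm V) (hσ : ∀ u v : V, X.Adj (σ u) (σ v) ↔ X.Adj u v)
    (ha : σ a = a) :
    σ b = b := by
  have hfix : σ.permMatrix ℝ *ᵥ Pi.single a 1 = Pi.single a 1 := by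
    rw [permMatrix_mulVec]
    ext i
    have : σ i = a ↔ i = a := by rw [← σ.injective.eq_iff (a := i), ha]
    simp [Pi.single_apply, this]
  have hb := hdec.mulVec_eq_of_proj_eq_or_neg (X.commute_adjMatrix_permMatrix σ hσ) hsc hfix
  rw [permMatrix_mulVec] at hb
  simpa [Pi.single_apply] using congrFun hb b
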